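/- Let P be a Borel probability measure on ℝ, let ε ≥ 0, q ∈ ℝ, and ρ ∈ [0,1] with ρ ≤ F_P(q − ε). Then the worst-case coverage over the LP ambiguity set satisfies inf_{Q : LP_ε(P,Q) ≤ ρ} F_Q(q) = F_P(q − ε) − ρ. -/

import Mathlib

open MeasureTheory

/-- The Lévy–Prokhorov discrepancy `LP_ε(P,Q)` on `ℝ` (with the absolute-value metric). -/
noncomputable def LPdist {E : Type*} [NormedAddCommGroup E] [MeasurableSpace E]
    (ε : ℝ) (P Q : Measure E) : ENNReal :=
  ⨅ (γ : Measure (E × E)) (_ : γ.map Prod.fst = P ∧ γ.map Prod.snd = Q),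
    γ {p : E × E | ε < ‖p.1 - p.2‖}

/-- The CDF of a measure on `ℝ`: `F_μ(s) = μ((-∞, s])`. -/
noncomputable def cdf (μ : Measure ℝ) (s : ℝ) : ℝ := (μ (Set.Iic s)).toReal

/-- Mass of `P` at or below `s` can only be lost from `Iic (s + ε)` by moving further than `ε`. -/
theorem measure_Iic_le_add_LPdist (P Q : Measure ℝ) (ε q : ℝ) :
    P (Set.Iic (q - ε)) ≤ Q (Set.Iic q) + LPdist ε P Q := by
  simp only [LPdist, ENNReal.add_iInf]
  refine le_iInf₂ fun γ ⟨h₁, h₂⟩ => ?_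
  rw [← h₁, ← h₂, Measure.map_apply measurable_fst measurableSet_Iic,
    Measure.map_apply measurable_snd measurableSet_Iic]
  refine (measure_mono fun p hp => ?_).trans (measure_union_le _ _)
  simp only [Set.mem_preimage, Set.mem_Iic, Set.mem_union, Set.mem_ofPred_eq, Real.norm_eq_abs]
    at hp ⊢
  by_contra! h
  linarith [neg_le_of_abs_le h.2]

/-- The plan that sends a fraction `a` of the mass on `Iic (q - ε)` to `q + 1`, leaves a fraction
`b` of it in place, and shifts the mass on `Ioi (q - ε)` to the right by `ε`. -/
noncomputable def worstCasePlan (P : Measure ℝ) (ε q : ℝ) (a b : ENNReal) : Measure (ℝ × ℝ) :=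
  a • (P.restrict (Set.Iic (q - ε))).map (fun z => (z, q + 1))
    + b • (P.restrict (Set.Iic (q - ε))).map (fun z => (z, z))
    + (P.restrict (Set.Iic (q - ε))ᶜ).map (fun z => (z, z + ε))

theorem worstCasePlan_map_fst (P : Measure ℝ) (ε q : ℝ) {a b : ENNReal} (hab : a + b = 1) :
    (worstCasePlan P ε q a b).map Prod.fst = P := by
  have map_graph (μ : Measure ℝ) {f : ℝ → ℝ} (hf : Measurable f) :
      (μ.map fun z => (z, f z)).map Prod.fst = μ := by
    rw [Measure.map_map measurable_fst (by fun_prop)]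
    exact Measure.map_id
  rw [worstCasePlan, Measure.map_add _ _ measurable_fst, Measure.map_add _ _ measurable_fst,
    Measure.map_smul, Measure.map_smul, map_graph _ (by fun_prop), map_graph _ (by fun_prop),
    map_graph _ (by fun_prop), ← add_smul, hab, one_smul,
    Measure.restrict_add_restrict_compl measurableSet_Iic]

theorem worstCasePlan_apply (P : Measure ℝ) (ε q : ℝ) (a b : ENNReal) {s : Set (ℝ × ℝ)}
    (hs : MeasurableSet s) :
    worstCasePlan P ε q a b s =
      a * P ({z | (z, q + 1) ∈ s} ∩ Set.Iic (q - ε)) + b * P ({z | (z, z) ∈ s} ∩ Set.Iic (q - ε))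
        + P ({z | (z, z + ε) ∈ s} ∩ (Set.Iic (q - ε))ᶜ) := by
  have apply_graph (t : Set ℝ) {f : ℝ → ℝ} (hf : Measurable f) :
      ((P.restrict t).map fun z => (z, f z)) s = P ({z | (z, f z) ∈ s} ∩ t) := by
    have hg : Measurable fun z => (z, f z) := by fun_prop
    rw [Measure.map_apply hg hs, Measure.restrict_apply (hg hs)]
    rfl
  simp only [worstCasePlan, Measure.add_apply, Measure.smul_apply, smul_eq_mul]
  rw [apply_graph _ (by fun_prop), apply_graph _ (by fun_prop), apply_graph _ (by fun_prop)]

theorem worstCasePlan_far_le (P : Measure ℝ) {ε : ℝ} (q : ℝ) (a b : ENNReal) (hε : 0 ≤ ε) :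
    worstCasePlan P ε q a b {p | ε < ‖p.1 - p.2‖} ≤ a * P (Set.Iic (q - ε)) := by
  rw [worstCasePlan_apply _ _ _ _ _ (measurableSet_lt measurable_const (by fun_prop))]
  simp only [Set.mem_ofPred_eq, sub_self, norm_zero, not_lt.mpr hε, sub_add_cancel_left, norm_neg,
    Real.norm_of_nonneg hε, lt_irrefl, Set.ofPred_false, Set.empty_inter, measure_empty, mul_zero,
    add_zero]
  gcongr
  exact Set.inter_subset_right

theorem worstCasePlan_map_snd_Iic (P : Measure ℝ) {ε : ℝ} (q : ℝ) (a b : ENNReal) (hε : 0 ≤ ε) :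
    (worstCasePlan P ε q a b).map Prod.snd (Set.Iic q) = b * P (Set.Iic (q - ε)) := by
  rw [Measure.map_apply measurable_snd measurableSet_Iic,
    worstCasePlan_apply _ _ _ _ _ (measurable_snd measurableSet_Iic)]
  have moved : {z : ℝ | (z, q + 1) ∈ Prod.snd ⁻¹' Set.Iic q} ∩ Set.Iic (q - ε) = ∅ := by
    ext z; simp
  have kept : {z : ℝ | (z, z) ∈ Prod.snd ⁻¹' Set.Iic q} ∩ Set.Iic (q - ε) = Set.Iic (q - ε) := by
    ext z
    simp only [Set.mem_inter_iff, Set.mem_ofPred_eq, Set.mem_preimage, Set.mem_Iic]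
    exact ⟨And.right, fun h => ⟨by linarith, h⟩⟩
  have shifted : {z : ℝ | (z, z + ε) ∈ Prod.snd ⁻¹' Set.Iic q} ∩ (Set.Iic (q - ε))ᶜ = ∅ := by
    ext z
    simp only [Set.mem_inter_iff, Set.mem_ofPred_eq, Set.mem_preimage, Set.mem_Iic,
      Set.mem_compl_iff, Set.mem_empty_iff_false, iff_false]
    exact fun h => h.2 (by linarith [h.1])
  rw [moved, kept, shifted, measure_empty, mul_zero, zero_add, add_zero]

/-- Worst-case coverage over the LP ambiguity set:
`inf_{Q : LP_ε(P,Q) ≤ ρ} F_Q(q) = F_P(q - ε) - ρ`. -/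
theorem lp_worst_case_coverage (P : Measure ℝ) [IsProbabilityMeasure P]
    (ε q ρ : ℝ) (hε : 0 ≤ ε) (hρ0 : 0 ≤ ρ) (hρ1 : ρ ≤ 1) (hρF : ρ ≤ cdf P (q - ε)) :
    sInf {x : ℝ | ∃ Q : Measure ℝ, IsProbabilityMeasure Q ∧
        LPdist ε P Q ≤ ENNReal.ofReal ρ ∧ cdf Q q = x}
      = cdf P (q - ε) - ρ := by
  refine IsLeast.csInf_eq ⟨?_, ?_⟩
  · set t := ρ / cdf P (q - ε) with ht
    have hF0 : 0 ≤ cdf P (q - ε) := hρ0.trans hρF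
    have ht0 : 0 ≤ t := div_nonneg hρ0 hF0
    have ht1 : t ≤ 1 := div_le_one_of_le₀ hρF hF0
    have htF : t * cdf P (q - ε) = ρ := div_mul_cancel_of_imp fun h => by linarith
    have hP : P (Set.Iic (q - ε)) = ENNReal.ofReal (cdf P (q - ε)) :=
      (ENNReal.ofReal_toReal (measure_ne_top _ _)).symm
    let γ := worstCasePlan P ε q (ENNReal.ofReal t) (ENNReal.ofReal (1 - t))
    have hγ : γ.map Prod.fst = P := worstCasePlan_map_fst P ε q <| by
      rw [← ENNReal.ofReal_add ht0 (by linarith), add_sub_cancel, ENNReal.ofReal_one]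
    have : IsProbabilityMeasure (γ.map Prod.fst) := by rwa [hγ]
    have : IsProbabilityMeasure γ := Measure.isProbabilityMeasure_of_map Prod.fst
    refine ⟨γ.map Prod.snd, Measure.isProbabilityMeasure_map measurable_snd.aemeasurable, ?_, ?_⟩
    · refine (iInf₂_le γ ⟨hγ, rfl⟩).trans ((worstCasePlan_far_le P q _ _ hε).trans_eq ?_)
      rw [hP, ← ENNReal.ofReal_mul ht0, htF]
    · rw [cdf, worstCasePlan_map_snd_Iic P q _ _ hε, ENNReal.toReal_mul,
        ENNReal.toReal_ofReal (by linarith), ← cdf]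
      linarith
  · rintro _ ⟨Q, _, hQ, rfl⟩
    have h : P (Set.Iic (q - ε)) ≤ Q (Set.Iic q) + ENNReal.ofReal ρ :=
      (measure_Iic_le_add_LPdist P Q ε q).trans (by gcongr)
    have := ENNReal.toReal_mono (by finiteness) h
    rw [ENNReal.toReal_add (by finiteness) (by finiteness), ENNReal.toReal_ofReal hρ0] at this
    exact sub_le_iff_le_add.mpr this
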